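/- (Lemma 2 of the appendix) Assume N ≥ 3, let T be an N×N complex Hermitian matrix with T_{N−1,N−1} = 1, and let q ∈ ℂ and k, l ∈ ℝ satisfy the matrix equations J₊·T + k·(J₋·T) + l·(T·J₊) = (conj q)·T and T·J₋ + l·(J₋·T) + k·(T·J₊) = q·T. Then: (i) for every natural number h with 2h ≤ N−1 there exist nonnegative reals a_0, …, a_h with a_h > 0 such that T_{N−1, N−1−2h} = Σ_{i=0}^{h} a_i · q^{2i} · (−k)^{h−i}; and (ii) for every natural number h with 2h+1 ≤ N−1 there exist nonnegative reals b_0, …, b_h with b_h > 0 such that T_{N−1, N−1−(2h+1)} = Σ_{i=0}^{h} b_i · q^{2i+1} · (−k)^{h−i}. -/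

import Mathlib

open Matrix

/-- Ladder coefficients c_a = √((N−1−a)(a+1)), so that c_{N−1} = 0. -/
noncomputable def spinC (N a : ℕ) : ℝ :=
  Real.sqrt (((N : ℝ) - 1 - a) * (a + 1))

/-- Raising operator J₊: (J₊)_{a+1,a} = c_a, all other entries 0. -/
noncomputable def Jp (N : ℕ) : Matrix (Fin N) (Fin N) ℂ :=
  Matrix.of fun a b => if (a : ℕ) = (b : ℕ) + 1 then ((spinC N b : ℝ) : ℂ) else 0

/-- Lowering operator J₋ = J₊ᵀ. -/
noncomputable def Jm (N : ℕ) : Matrix (Fin N) (Fin N) ℂ := (Jp N)ᵀ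

/-- J_z = diag(a − (N−1)/2). -/
noncomputable def Jz (N : ℕ) : Matrix (Fin N) (Fin N) ℂ :=
  Matrix.diagonal fun a => ((a : ℂ) - ((N : ℂ) - 1) / 2)

/-- J_x = (J₊ + J₋)/2. -/
noncomputable def Jx (N : ℕ) : Matrix (Fin N) (Fin N) ℂ :=
  (1 / 2 : ℂ) • (Jp N + Jm N)

/-- J_y = (J₊ − J₋)/(2i). -/
noncomputable def Jy (N : ℕ) : Matrix (Fin N) (Fin N) ℂ :=
  (1 / (2 * Complex.I)) • (Jp N - Jm N)

/-- The number `z` is `∑ i ≤ h, a i * q ^ (2 * i + e) * p ^ (h - i)` for nonnegative reals `a i`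
with `a h > 0`. -/
def IsNonnegForm (q p : ℂ) (e h : ℕ) (z : ℂ) : Prop :=
  ∃ a : ℕ → ℝ, (∀ i, 0 ≤ a i) ∧ 0 < a h ∧ (∀ i, h < i → a i = 0) ∧
    z = ∑ i ∈ Finset.range (h + 1), ((a i : ℝ) : ℂ) * q ^ (2 * i + e) * p ^ (h - i)

namespace IsNonnegForm

variable {q p : ℂ} {h : ℕ} {w y z : ℂ} {c d : ℝ}

lemma one : IsNonnegForm q p 0 0 1 :=
  ⟨fun i => if i = 0 then 1 else 0, fun i => by positivity, by simp,
    fun i hi => by simp [hi.ne'], by simp⟩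

lemma odd_zero (hz : IsNonnegForm q p 0 0 z) (hd : 0 < d) (hy : d * y = q * z) :
    IsNonnegForm q p 1 0 y := by
  obtain ⟨a, ha, ha0, haz, rfl⟩ := hz
  refine ⟨fun i => a i / d, fun i => div_nonneg (ha i) hd.le, div_pos ha0 hd,
    fun i hi => by simp [haz i hi], ?_⟩
  have hd' : (d : ℂ) ≠ 0 := by exact_mod_cast hd.ne'
  apply mul_left_cancel₀ hd'
  rw [hy]
  simp
  field_simp

lemma extend_sum (a : ℕ → ℝ) (ha : ∀ i, h < i → a i = 0) (e : ℕ) :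
    p * ∑ i ∈ Finset.range (h + 1), ((a i : ℝ) : ℂ) * q ^ (2 * i + e) * p ^ (h - i) =
      ∑ i ∈ Finset.range (h + 1 + 1), ((a i : ℝ) : ℂ) * q ^ (2 * i + e) * p ^ (h + 1 - i) := by
  rw [Finset.sum_range_succ _ (h + 1), ha (h + 1) (Nat.lt_succ_self h), Finset.mul_sum]
  simp only [Complex.ofReal_zero, zero_mul, add_zero]
  refine Finset.sum_congr rfl fun i hi => ?_
  rw [Nat.succ_sub (Finset.mem_range_succ_iff.mp hi), pow_succ]
  ring

lemma odd_succ (hz : IsNonnegForm q p 0 (h + 1) z) (hw : IsNonnegForm q p 1 h w)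
    (hc : 0 ≤ c) (hd : 0 < d) (hy : d * y = q * z + p * c * w) :
    IsNonnegForm q p 1 (h + 1) y := by
  obtain ⟨a, ha, ha0, haz, rfl⟩ := hz
  obtain ⟨b, hb, -, hbz, rfl⟩ := hw
  refine ⟨fun i => (a i + c * b i) / d,
    fun i => div_nonneg (add_nonneg (ha i) (mul_nonneg hc (hb i))) hd.le,
    div_pos (add_pos_of_pos_of_nonneg ha0 (mul_nonneg hc (hb _))) hd,
    fun i hi => by simp [haz i hi, hbz i (by omega)], ?_⟩
  have hd' : (d : ℂ) ≠ 0 := by exact_mod_cast hd.ne'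
  apply mul_left_cancel₀ hd'
  rw [hy, mul_comm p, mul_assoc, extend_sum b hbz, Finset.mul_sum, Finset.mul_sum,
    Finset.mul_sum, ← Finset.sum_add_distrib]
  refine Finset.sum_congr rfl fun i _ => ?_
  push_cast
  field_simp
  ring

lemma even_succ (hz : IsNonnegForm q p 1 h z) (hw : IsNonnegForm q p 0 h w)
    (hc : 0 ≤ c) (hd : 0 < d) (hy : d * y = q * z + p * c * w) :
    IsNonnegForm q p 0 (h + 1) y := by
  obtain ⟨b, hb, hb0, hbz, rfl⟩ := hz
  obtain ⟨a, ha, -, haz, rfl⟩ := hw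
  let s : ℕ → ℝ := fun i => if i = 0 then 0 else b (i - 1)
  have hs : ∀ i, 0 ≤ s i := fun i => by
    dsimp only [s]
    split_ifs
    exacts [le_rfl, hb _]
  have hs_succ : ∀ i, s (i + 1) = b i := fun i => by simp [s]
  have hshift : q * ∑ i ∈ Finset.range (h + 1), ((b i : ℝ) : ℂ) * q ^ (2 * i + 1) * p ^ (h - i) =
      ∑ i ∈ Finset.range (h + 1 + 1),
        ((s i : ℝ) : ℂ) * q ^ (2 * i + 0) * p ^ (h + 1 - i) := by
    rw [Finset.sum_range_succ' _ (h + 1), Finset.mul_sum]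
    simp only [hs_succ, Nat.add_sub_add_right]
    simp only [s, if_true, Complex.ofReal_zero, zero_mul, add_zero]
    exact Finset.sum_congr rfl fun i _ => by ring
  refine ⟨fun i => (s i + c * a i) / d,
    fun i => div_nonneg (add_nonneg (hs i) (mul_nonneg hc (ha i))) hd.le,
    div_pos (add_pos_of_pos_of_nonneg (by rwa [hs_succ]) (mul_nonneg hc (ha _))) hd,
    fun i hi => ?_, ?_⟩
  · obtain ⟨j, rfl⟩ : ∃ j, i = j + 1 := ⟨i - 1, by omega⟩
    simp [hs_succ, hbz j (by omega), haz (j + 1) (by omega)]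
  have hd' : (d : ℂ) ≠ 0 := by exact_mod_cast hd.ne'
  apply mul_left_cancel₀ hd'
  rw [hy, mul_comm p, mul_assoc, extend_sum a haz, hshift, Finset.mul_sum,
    Finset.mul_sum, ← Finset.sum_add_distrib]
  refine Finset.sum_congr rfl fun i _ => ?_
  push_cast
  field_simp

lemma exists_fin {e : ℕ} (hz : IsNonnegForm q p e h z) :
    ∃ a : Fin (h + 1) → ℝ, (∀ i, 0 ≤ a i) ∧ 0 < a (Fin.last h) ∧
      z = ∑ i : Fin (h + 1), ((a i : ℝ) : ℂ) * q ^ (2 * (i : ℕ) + e) * p ^ (h - (i : ℕ)) := by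
  obtain ⟨a, ha, ha0, -, rfl⟩ := hz
  exact ⟨fun i => a i, fun i => ha i, by simpa using ha0, by rw [Finset.sum_range]⟩

end IsNonnegForm

lemma spinC_pos {N a : ℕ} (h : a + 1 < N) : 0 < spinC N a := by
  have h' : (a : ℝ) + 1 < N := by exact_mod_cast h
  exact Real.sqrt_pos.mpr (mul_pos (by linarith) (by positivity))

lemma mul_Jp_apply {N : ℕ} (T : Matrix (Fin N) (Fin N) ℂ) (r b : Fin N) (hb : (b : ℕ) + 1 < N) :
    (T * Jp N) r b = T r ⟨b + 1, hb⟩ * spinC N b := by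
  rw [Matrix.mul_apply, Finset.sum_eq_single ⟨b + 1, hb⟩]
  · simp [Jp]
  · intro x _ hx
    have : (x : ℕ) ≠ b + 1 := fun h => hx (Fin.ext h)
    simp [Jp, this]
  · simp

lemma mul_Jp_apply_last {N : ℕ} (T : Matrix (Fin N) (Fin N) ℂ) (r b : Fin N)
    (hb : N ≤ (b : ℕ) + 1) : (T * Jp N) r b = 0 := by
  rw [Matrix.mul_apply]
  refine Finset.sum_eq_zero fun x _ => ?_
  have : (x : ℕ) ≠ b + 1 := by omega
  simp [Jp, this]

lemma mul_Jm_apply {N : ℕ} (T : Matrix (Fin N) (Fin N) ℂ) (r b : Fin N) (a : ℕ)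
    (hb : (b : ℕ) = a + 1) :
    (T * Jm N) r b = T r ⟨a, by omega⟩ * spinC N a := by
  rw [Matrix.mul_apply, Finset.sum_eq_single ⟨a, by omega⟩]
  · simp [Jm, Jp, hb]
  · intro x _ hx
    have : (b : ℕ) ≠ x + 1 := fun h => hx (Fin.ext (show (x : ℕ) = a by omega))
    simp [Jm, Jp, this]
  · simp

lemma Jm_mul_apply_last {N : ℕ} (T : Matrix (Fin N) (Fin N) ℂ) (r b : Fin N)
    (hr : N ≤ (r : ℕ) + 1) : (Jm N * T) r b = 0 := by
  rw [Matrix.mul_apply]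
  refine Finset.sum_eq_zero fun x _ => ?_
  have : (x : ℕ) ≠ r + 1 := by omega
  simp [Jm, Jp, this]

/-- Lemma 2: the last-row entries of T are polynomials in q and −k with
nonnegative coefficients and positive leading coefficient. -/
theorem lemma2_last_row_form (N : ℕ) (hN : 3 ≤ N)
    (T : Matrix (Fin N) (Fin N) ℂ) (hT : T.IsHermitian)
    (hT1 : T ⟨N - 1, by omega⟩ ⟨N - 1, by omega⟩ = 1)
    (q : ℂ) (k l : ℝ)
    (heq1 : Jp N * T + (k : ℂ) • (Jm N * T) + (l : ℂ) • (T * Jp N)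
      = (starRingEnd ℂ q) • T)
    (heq2 : T * Jm N + (l : ℂ) • (Jm N * T) + (k : ℂ) • (T * Jp N) = q • T) :
    (∀ h : ℕ, (h2 : 2 * h ≤ N - 1) →
      ∃ a : Fin (h + 1) → ℝ, (∀ i, 0 ≤ a i) ∧ 0 < a (Fin.last h) ∧
        T ⟨N - 1, by omega⟩ ⟨N - 1 - 2 * h, by omega⟩ =
          ∑ i : Fin (h + 1), ((a i : ℝ) : ℂ) * q ^ (2 * (i : ℕ)) * (-(k : ℂ)) ^ (h - (i : ℕ))) ∧
    (∀ h : ℕ, (h2 : 2 * h + 1 ≤ N - 1) →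
      ∃ b : Fin (h + 1) → ℝ, (∀ i, 0 ≤ b i) ∧ 0 < b (Fin.last h) ∧
        T ⟨N - 1, by omega⟩ ⟨N - 1 - (2 * h + 1), by omega⟩ =
          ∑ i : Fin (h + 1), ((b i : ℝ) : ℂ) * q ^ (2 * (i : ℕ) + 1) * (-(k : ℂ)) ^ (h - (i : ℕ))) := by
  have hrow : ∀ b : Fin N, (T * Jm N) ⟨N - 1, by omega⟩ b
      + k * (T * Jp N) ⟨N - 1, by omega⟩ b = q * T ⟨N - 1, by omega⟩ b := by
    intro b
    have h := congrFun (congrFun heq2 ⟨N - 1, by omega⟩) b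
    simp only [Matrix.add_apply, Matrix.smul_apply, smul_eq_mul] at h
    rwa [Jm_mul_apply_last T _ b (by simp only; omega), mul_zero, add_zero] at h
  have hfirst : (spinC N (N - 1 - 1) : ℂ) * T ⟨N - 1, by omega⟩ ⟨N - 1 - 1, by omega⟩ =
      q * T ⟨N - 1, by omega⟩ ⟨N - 1, by omega⟩ := by
    have h := hrow ⟨N - 1, by omega⟩
    rw [mul_Jm_apply T _ _ (N - 1 - 1) (by simp only; omega),
      mul_Jp_apply_last T _ _ (by simp only; omega)] at h
    linear_combination h
  have hstep : ∀ n, (hn : n + 2 ≤ N - 1) →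
      (spinC N (N - 1 - (n + 2)) : ℂ) * T ⟨N - 1, by omega⟩ ⟨N - 1 - (n + 2), by omega⟩ =
        q * T ⟨N - 1, by omega⟩ ⟨N - 1 - (n + 1), by omega⟩ +
          -(k : ℂ) * spinC N (N - 1 - (n + 1)) * T ⟨N - 1, by omega⟩ ⟨N - 1 - n, by omega⟩ := by
    intro n hn
    have h := hrow ⟨N - 1 - (n + 1), by omega⟩
    rw [mul_Jm_apply T _ _ (N - 1 - (n + 2)) (by simp only; omega),
      mul_Jp_apply T _ _ (by simp only; omega)] at h
    have hidx : N - 1 - (n + 1) + 1 = N - 1 - n := by omega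
    simp only [hidx] at h
    linear_combination h
  have key : ∀ h : ℕ,
      ((h2 : 2 * h ≤ N - 1) →
        IsNonnegForm q (-(k : ℂ)) 0 h (T ⟨N - 1, by omega⟩ ⟨N - 1 - 2 * h, by omega⟩)) ∧
      ((h2 : 2 * h + 1 ≤ N - 1) →
        IsNonnegForm q (-(k : ℂ)) 1 h (T ⟨N - 1, by omega⟩ ⟨N - 1 - (2 * h + 1), by omega⟩)) := by
    intro h
    induction h with
    | zero =>
      have h0 : IsNonnegForm q (-(k : ℂ)) 0 0 (T ⟨N - 1, by omega⟩ ⟨N - 1, by omega⟩) :=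
        hT1 ▸ IsNonnegForm.one
      exact ⟨fun _ => h0, fun _ => h0.odd_zero (spinC_pos (by omega)) hfirst⟩
    | succ h ih =>
      have heven : (h2 : 2 * (h + 1) ≤ N - 1) → IsNonnegForm q (-(k : ℂ)) 0 (h + 1)
          (T ⟨N - 1, by omega⟩ ⟨N - 1 - 2 * (h + 1), by omega⟩) := fun h2 =>
        (ih.2 (by omega)).even_succ (ih.1 (by omega)) (Real.sqrt_nonneg _)
          (spinC_pos (by omega)) (hstep (2 * h) h2)
      exact ⟨heven, fun h2 => (heven (by omega)).odd_succ (ih.2 (by omega)) (Real.sqrt_nonneg _)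
        (spinC_pos (by omega)) (hstep (2 * h + 1) h2)⟩
  exact ⟨fun h h2 => ((key h).1 h2).exists_fin, fun h h2 => ((key h).2 h2).exists_fin⟩
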